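/- Let i be a nonnegative integer, x a complex number, and α a complex number such that 2α+i is not a nonpositive integer and α+m+1/2 is not a nonpositive integer for 0 ≤ m ≤ i, and (α−1/2)_m ≠ 0 for 0 ≤ m ≤ i. Then e^{−x/2} · ₁F₁(α; 2α+i; x) = Σ_{m=0}^{i} [(−i)_m (2α−1)_m] / [(2α+i)_m (α−1/2)_m m! 2^{2m}] · x^m · ₀F₁(—; α+m+1/2; x²/16). -/

import Mathlib

/-- Pochhammer symbol (rising factorial) `(c)_k = c (c+1) ⋯ (c+k-1)` for complex `c`. -/
noncomputable def poch (c : ℂ) (k : ℕ) : ℂ := ∏ l ∈ Finset.range k, (c + l)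

/-- Generalized hypergeometric series `ₚF_q(a; b; x) = Σ_k (a₁)_k⋯(a_p)_k / ((b₁)_k⋯(b_q)_k) · x^k/k!`. -/
noncomputable def pFq (a b : List ℂ) (x : ℂ) : ℂ :=
  ∑' k : ℕ, ((a.map (fun c => poch c k)).prod / (b.map (fun c => poch c k)).prod)
    * x ^ k / (Nat.factorial k)

/-- `c` is not a nonpositive integer, i.e. `c ≠ 0, -1, -2, …`. -/
def NotNonposInt (c : ℂ) : Prop := ∀ n : ℕ, c ≠ -(n : ℂ)

open PowerSeries in
/-- The Euler operator `X · d/dX` on formal power series. -/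
noncomputable def eulerOp (f : PowerSeries ℂ) : PowerSeries ℂ := X * derivative ℂ f

/-- The formal power series of `₀F₁(—; b; X² / 16)`. -/
noncomputable def besselSeries (b : ℂ) : PowerSeries ℂ :=
  PowerSeries.mk fun n =>
    if Even n then 1 / (poch b (n / 2) * (Nat.factorial (n / 2)) * 16 ^ (n / 2)) else 0

/-- The formal power series of `₁F₁(a; c; X)`. -/
noncomputable def kummerSeries (a c : ℂ) : PowerSeries ℂ :=
  PowerSeries.mk fun n => poch a n / poch c n / (Nat.factorial n)

/-- `X` times the differential operator annihilating `e^{-X/2} ₁F₁(α; 2α + t; X)`,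
with `ν = α - 1/2`. -/
noncomputable def kummerOp (ν t : ℂ) (f : PowerSeries ℂ) : PowerSeries ℂ :=
  eulerOp (eulerOp f) + PowerSeries.C (2 * ν + t) * eulerOp f
    + PowerSeries.C (t / 2) * PowerSeries.X * f - PowerSeries.C (1 / 4) * PowerSeries.X ^ 2 * f

section Pochhammer

theorem poch_zero (c : ℂ) : poch c 0 = 1 := by simp [poch]

theorem poch_succ (c : ℂ) (k : ℕ) : poch c (k + 1) = poch c k * (c + k) := by
  simp [poch, Finset.prod_range_succ]

theorem poch_succ_left (c : ℂ) (k : ℕ) : poch c (k + 1) = c * poch (c + 1) k := by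
  induction k with
  | zero => simp [poch]
  | succ k ih => rw [poch_succ, ih, poch_succ]; push_cast; ring

theorem NotNonposInt.add_ne_zero {c : ℂ} (h : NotNonposInt c) (n : ℕ) : c + n ≠ 0 :=
  fun e => h n (eq_neg_of_add_eq_zero_left e)

theorem NotNonposInt.ne_zero {c : ℂ} (h : NotNonposInt c) : c ≠ 0 := by
  simpa using h.add_ne_zero 0

theorem NotNonposInt.add_one {c : ℂ} (h : NotNonposInt c) : NotNonposInt (c + 1) := by
  intro n e
  apply h (n + 1)
  push_cast
  linear_combination e

theorem NotNonposInt.poch_ne_zero {c : ℂ} (h : NotNonposInt c) (k : ℕ) : poch c k ≠ 0 :=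
  Finset.prod_ne_zero_iff.mpr fun l _ => h.add_ne_zero l

theorem poch_neg_natCast_eq_zero {i k : ℕ} (h : i < k) : poch (-(i : ℂ)) k = 0 :=
  Finset.prod_eq_zero (Finset.mem_range.mpr h) (by simp)

end Pochhammer

section FormalSeries

open PowerSeries

theorem eulerOp_add (f g : PowerSeries ℂ) : eulerOp (f + g) = eulerOp f + eulerOp g := by
  simp [eulerOp, mul_add]

theorem eulerOp_mul (f g : PowerSeries ℂ) :
    eulerOp (f * g) = eulerOp f * g + f * eulerOp g := by
  simp only [eulerOp, Derivation.leibniz, smul_eq_mul]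
  ring

theorem eulerOp_C (a : ℂ) : eulerOp (C a) = 0 := by
  simp [eulerOp]

theorem eulerOp_X : eulerOp X = X := by
  simp [eulerOp]

theorem coeff_eulerOp (f : PowerSeries ℂ) (n : ℕ) :
    coeff n (eulerOp f) = n * coeff n f := by
  cases n with
  | zero => simp [eulerOp]
  | succ n =>
    rw [eulerOp, coeff_succ_X_mul, coeff_derivative]
    push_cast
    ring

theorem eulerOp_X_pow (m : ℕ) : eulerOp (X ^ m) = C (m : ℂ) * X ^ m := by
  induction m with
  | zero => simp [eulerOp]
  | succ m ih =>
    rw [pow_succ, eulerOp_mul, ih, eulerOp_X]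
    push_cast
    simp only [map_add, map_one]
    ring

theorem kummerOp_add (ν t : ℂ) (f g : PowerSeries ℂ) :
    kummerOp ν t (f + g) = kummerOp ν t f + kummerOp ν t g := by
  simp only [kummerOp, eulerOp_add]
  ring

theorem kummerOp_C_mul (ν t a : ℂ) (f : PowerSeries ℂ) :
    kummerOp ν t (C a * f) = C a * kummerOp ν t f := by
  simp only [kummerOp, eulerOp_mul, eulerOp_C, zero_mul, zero_add]
  ring

/-- A formal solution of the differential equation is determined by its constant term. -/
theorem eq_of_kummerOp_eq_zero {ν t : ℂ} (h : NotNonposInt (2 * ν + 1 + t))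
    {f g : PowerSeries ℂ} (hf : kummerOp ν t f = 0) (hg : kummerOp ν t g = 0)
    (h0 : coeff 0 f = coeff 0 g) : f = g := by
  have key : ∀ (f : PowerSeries ℂ), kummerOp ν t f = 0 →
      coeff 1 f * (2 * ν + 1 + t) = - (t / 2 * coeff 0 f) ∧
      ∀ n : ℕ, coeff (n + 2) f * ((n + 2) * (2 * ν + 1 + t + ((n + 1 : ℕ) : ℂ))) =
        1 / 4 * coeff n f - t / 2 * coeff (n + 1) f := by
    intro f hf
    constructor
    · have := congrArg (coeff 1) hf
      simp only [kummerOp, map_add (coeff 1), map_sub (coeff 1), mul_assoc, coeff_C_mul,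
        coeff_eulerOp, map_zero, pow_succ, pow_zero, one_mul] at this
      rw [show (1 : ℕ) = 0 + 1 from rfl, coeff_succ_X_mul, coeff_succ_X_mul,
        coeff_zero_X_mul] at this
      push_cast at this
      linear_combination this
    · intro n
      have := congrArg (coeff (n + 2)) hf
      simp only [kummerOp, map_add (coeff (n + 2)), map_sub (coeff (n + 2)), mul_assoc,
        coeff_C_mul, coeff_eulerOp, coeff_X_pow_mul, map_zero] at this
      rw [show n + 2 = (n + 1) + 1 from rfl, coeff_succ_X_mul] at this
      push_cast at this ⊢
      linear_combination this
  obtain ⟨f1, f2⟩ := key f hf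
  obtain ⟨g1, g2⟩ := key g hg
  have step : ∀ n, coeff n f = coeff n g ∧ coeff (n + 1) f = coeff (n + 1) g := by
    intro n
    induction n with
    | zero =>
      refine ⟨h0, mul_right_cancel₀ h.ne_zero ?_⟩
      rw [zero_add, f1, g1, h0]
    | succ n ih =>
      have hn : (n : ℂ) + 2 ≠ 0 := by exact_mod_cast (by omega : n + 2 ≠ 0)
      refine ⟨ih.2, mul_right_cancel₀ (mul_ne_zero hn (h.add_ne_zero (n + 1))) ?_⟩
      rw [f2, g2, ih.1, ih.2]
  ext n
  exact (step n).1

theorem eulerOp_kummerSeries (a c : ℂ) (hc : NotNonposInt c) :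
    eulerOp (eulerOp (kummerSeries a c)) + C (c - 1) * eulerOp (kummerSeries a c)
      = X * eulerOp (kummerSeries a c) + C a * (X * kummerSeries a c) := by
  ext n
  cases n with
  | zero =>
    simp only [map_add, coeff_C_mul, coeff_eulerOp, coeff_zero_X_mul]
    simp
  | succ n =>
    simp only [map_add, coeff_C_mul, coeff_eulerOp, coeff_succ_X_mul]
    simp only [kummerSeries, coeff_mk, poch_succ, Nat.factorial_succ]
    have h1 := hc.poch_ne_zero n
    have h2 := hc.add_ne_zero n
    have h3 : (Nat.factorial n : ℂ) ≠ 0 := by exact_mod_cast n.factorial_ne_zero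
    have h4 : (n : ℂ) + 1 ≠ 0 := by exact_mod_cast n.succ_ne_zero
    push_cast
    field_simp
    ring

theorem eulerOp_rescale_exp (a : ℂ) :
    eulerOp (rescale a (PowerSeries.exp ℂ)) = C a * (X * rescale a (PowerSeries.exp ℂ)) := by
  ext n
  cases n with
  | zero => simp [coeff_eulerOp]
  | succ n =>
    simp only [coeff_C_mul, coeff_eulerOp, coeff_succ_X_mul, coeff_rescale, coeff_exp,
      Nat.factorial_succ, map_div₀, map_one, map_natCast]
    have h3 : (Nat.factorial n : ℂ) ≠ 0 := by exact_mod_cast n.factorial_ne_zero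
    have h4 : (n : ℂ) + 1 ≠ 0 := by exact_mod_cast n.succ_ne_zero
    push_cast
    field_simp
    ring

theorem kummerOp_exp_mul_kummerSeries (ν t : ℂ) (hc : NotNonposInt (2 * ν + 1 + t)) :
    kummerOp ν t (rescale (-1 / 2) (PowerSeries.exp ℂ) *
      kummerSeries (ν + 1 / 2) (2 * ν + 1 + t)) = 0 := by
  have hU := eulerOp_kummerSeries (ν + 1 / 2) _ hc
  set U := kummerSeries (ν + 1 / 2) (2 * ν + 1 + t)
  have hE := eulerOp_rescale_exp (-1 / 2)
  set E := rescale (-1 / 2 : ℂ) (PowerSeries.exp ℂ)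
  simp only [kummerOp, eulerOp_mul, hE, eulerOp_C, eulerOp_X, eulerOp_add]
  have e1 : (C (2 * ν + 1 + t - 1) : PowerSeries ℂ) = C (2 * ν + t) := by congr 1; ring
  have e2 : (C (-1 / 2) : PowerSeries ℂ) = - C (1 / 2) := by rw [← map_neg]; congr 1; ring
  have e3 : (C (ν + 1 / 2) : PowerSeries ℂ) = C ν + C (1 / 2) := map_add _ _ _
  have e4 : (C (2 * ν + t) : PowerSeries ℂ) = C (1 / 2) * C (t / 2) * 4 + 2 * C ν := by
    rw [show (4 : PowerSeries ℂ) = C 4 from rfl, show (2 : PowerSeries ℂ) = C 2 from rfl,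
      ← map_mul, ← map_mul, ← map_mul, ← map_add]
    congr 1; ring
  have e5 : (C (1 / 4) : PowerSeries ℂ) = C (1 / 2) ^ 2 := by rw [← map_pow]; congr 1; norm_num
  have e6 : 2 * (C (1 / 2) : PowerSeries ℂ) = 1 := by
    rw [show (2 : PowerSeries ℂ) = C 2 from rfl, ← map_mul]; norm_num
  rw [e1, e3, e4] at hU
  rw [e2, e4, e5]
  generalize (C (1 / 2) : PowerSeries ℂ) = s at *
  generalize (C (t / 2) : PowerSeries ℂ) = r at *
  generalize (C ν : PowerSeries ℂ) = n at *
  linear_combination E * hU - (X * E * eulerOp U + r * X * E * U * (2 * s + 1) + X * E * U * n) * e6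

theorem coeff_besselSeries_two_mul (b : ℂ) (k : ℕ) :
    coeff (2 * k) (besselSeries b) = 1 / (poch b k * (Nat.factorial k) * 16 ^ k) := by
  simp [besselSeries]

theorem coeff_besselSeries_two_mul_add_one (b : ℂ) (k : ℕ) :
    coeff (2 * k + 1) (besselSeries b) = 0 := by
  simp [besselSeries]

theorem eulerOp_besselSeries (b : ℂ) (hb : NotNonposInt b) :
    eulerOp (besselSeries b) = C (1 / (8 * b)) * (X ^ 2 * besselSeries (b + 1)) := by
  ext n
  obtain ⟨k, rfl | rfl⟩ := n.even_or_odd'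
  · cases k with
    | zero => simp [coeff_eulerOp]
    | succ k =>
      rw [coeff_C_mul, coeff_eulerOp, coeff_besselSeries_two_mul, mul_add, mul_one,
        coeff_X_pow_mul, coeff_besselSeries_two_mul, poch_succ_left, Nat.factorial_succ]
      have h1 := hb.add_one.poch_ne_zero k
      have h2 := hb.ne_zero
      have h3 : (Nat.factorial k : ℂ) ≠ 0 := by exact_mod_cast k.factorial_ne_zero
      have h4 : (k : ℂ) + 1 ≠ 0 := by exact_mod_cast k.succ_ne_zero
      push_cast
      field_simp
      ring
  · cases k with
    | zero =>
      rw [coeff_C_mul, coeff_eulerOp, coeff_besselSeries_two_mul_add_one]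
      simp [coeff_X_pow_mul']
    | succ k =>
      rw [coeff_C_mul, coeff_eulerOp, coeff_besselSeries_two_mul_add_one,
        show 2 * (k + 1) + 1 = (2 * k + 1) + 2 by ring,
        coeff_X_pow_mul, coeff_besselSeries_two_mul_add_one]
      simp

theorem besselSeries_sub_besselSeries (b : ℂ) (hb : NotNonposInt b) :
    besselSeries b - besselSeries (b + 1) =
      C (1 / (16 * b * (b + 1))) * (X ^ 2 * besselSeries (b + 1 + 1)) := by
  ext n
  obtain ⟨k, rfl | rfl⟩ := n.even_or_odd'
  · cases k with
    | zero => simp [besselSeries, poch_zero]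
    | succ k =>
      have h1 := hb.add_one.poch_ne_zero k
      have h1' := hb.add_one.add_one.poch_ne_zero k
      have h2 := hb.ne_zero
      have h2' := hb.add_one.ne_zero
      have h2'' := hb.add_one.add_ne_zero k
      have h3 : (Nat.factorial k : ℂ) ≠ 0 := by exact_mod_cast k.factorial_ne_zero
      have h4 : (k : ℂ) + 1 ≠ 0 := by exact_mod_cast k.succ_ne_zero
      have h5 : poch (b + 1 + 1) k = poch (b + 1) k * (b + 1 + k) / (b + 1) := by
        rw [← poch_succ, poch_succ_left]
        field_simp
      rw [coeff_C_mul, map_sub, coeff_besselSeries_two_mul, coeff_besselSeries_two_mul,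
        show 2 * (k + 1) = 2 * k + 2 by ring, coeff_X_pow_mul, coeff_besselSeries_two_mul,
        poch_succ_left b,
        poch_succ (b + 1), h5, Nat.factorial_succ]
      push_cast
      field_simp
      ring
  · rw [map_sub, coeff_besselSeries_two_mul_add_one, coeff_besselSeries_two_mul_add_one]
    cases k with
    | zero => rw [coeff_C_mul, coeff_X_pow_mul']; simp
    | succ k =>
      rw [coeff_C_mul, show 2 * (k + 1) + 1 = (2 * k + 1) + 2 by ring,
        coeff_X_pow_mul, coeff_besselSeries_two_mul_add_one]
      simp

theorem kummerOp_X_pow_mul_besselSeries (ν t : ℂ) (m : ℕ) (hb : NotNonposInt (ν + m + 1)) :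
    kummerOp ν t (X ^ m * besselSeries (ν + m + 1)) =
      C (m * (m + 2 * ν + t)) * (X ^ m * besselSeries (ν + m + 1))
      + C (t / (8 * (ν + m + 1))) * (X ^ (m + 2) * besselSeries (ν + m + 1 + 1))
      + C (t / 2) * (X ^ (m + 1) * besselSeries (ν + m + 1)) := by
  have hb0 := hb.ne_zero
  have hb1 := hb.add_one.ne_zero
  have hG := eulerOp_besselSeries _ hb
  have hG1 := eulerOp_besselSeries _ hb.add_one
  have hS := besselSeries_sub_besselSeries _ hb
  set b := ν + m + 1 with hbdef
  have c1 : (C (1 / (8 * b)) * C (1 / (8 * (b + 1))) : PowerSeries ℂ)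
      = C (1 / 4) * C (1 / (16 * b * (b + 1))) := by
    rw [← map_mul, ← map_mul]; congr 1; field_simp; norm_num
  have c2 : (C (1 / 4) : PowerSeries ℂ) = C (1 / (8 * b)) * (2 * (C ν + C (m : ℂ) + 1)) := by
    rw [show (2 : PowerSeries ℂ) = C 2 from rfl, ← map_one C, ← map_add, ← map_add,
      ← map_mul, ← map_mul, ← hbdef]
    congr 1; field_simp; norm_num
  have c3 : (C (m * (m + 2 * ν + t)) : PowerSeries ℂ)
      = C (m : ℂ) * (C (m : ℂ) + 2 * C ν + C t) := by
    simp only [map_add, map_mul, map_ofNat]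
  have c4 : (C (2 * ν + t) : PowerSeries ℂ) = 2 * C ν + C t := by
    simp only [map_add, map_mul, map_ofNat]
  have c5 : (C (t / (8 * b)) : PowerSeries ℂ) = C t * C (1 / (8 * b)) := by
    rw [← map_mul]; congr 1; ring
  simp only [kummerOp, eulerOp_mul, hG, hG1, eulerOp_C, eulerOp_X_pow, eulerOp_add]
  rw [c3, c4, c5]
  push_cast
  simp only [map_ofNat]
  generalize (C (1 / (8 * b)) : PowerSeries ℂ) = s at *
  generalize (C (1 / (8 * (b + 1))) : PowerSeries ℂ) = s' at *
  generalize (C (1 / (16 * b * (b + 1))) : PowerSeries ℂ) = q at *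
  generalize (C (1 / 4) : PowerSeries ℂ) = f at *
  generalize besselSeries (b + 1 + 1) = G2 at *
  generalize besselSeries (b + 1) = G1 at *
  generalize besselSeries b = G0 at *
  linear_combination X ^ (m + 4) * G2 * c1 - X ^ (m + 2) * f * hS - X ^ (m + 2) * G1 * c2

/-- The coefficients of the expansion of `e^{-x/2} ₁F₁(ν + 1/2; 2ν + 1 + i; x)`. -/
noncomputable def kummerCoeff (i : ℕ) (ν : ℂ) (m : ℕ) : ℂ :=
  (poch (-(i : ℂ)) m * poch (2 * ν) m) /
    (poch (2 * ν + 1 + i) m * poch ν m * (Nat.factorial m) * 2 ^ (2 * m))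

theorem kummerCoeff_zero (i : ℕ) (ν : ℂ) : kummerCoeff i ν 0 = 1 := by
  simp [kummerCoeff, poch_zero]

theorem kummerCoeff_eq_zero {i m : ℕ} (ν : ℂ) (h : i < m) : kummerCoeff i ν m = 0 := by
  simp [kummerCoeff, poch_neg_natCast_eq_zero h]

theorem kummerCoeff_succ {i : ℕ} {ν : ℂ} (hc : NotNonposInt (2 * ν + 1 + i)) {m : ℕ}
    (hν : ν + m ≠ 0) :
    kummerCoeff i ν (m + 1) * ((m + 1) * (2 * ν + 1 + i + m)) =
      kummerCoeff i ν m * ((m - i) * (2 * ν + m)) / (4 * (ν + m)) := by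
  have h2 := hc.add_ne_zero m
  have h4 : (m : ℂ) + 1 ≠ 0 := by exact_mod_cast m.succ_ne_zero
  simp only [kummerCoeff, poch_succ, Nat.factorial_succ, mul_add, pow_add]
  push_cast
  field_simp
  ring

theorem kummerOp_sum_besselSeries {i : ℕ} {ν : ℂ} (hc : NotNonposInt (2 * ν + 1 + i))
    (hb : ∀ m ≤ i, NotNonposInt (ν + m + 1)) (hν : ∀ m < i, ν + m ≠ 0) {j : ℕ} (hj : j ≤ i) :
    kummerOp ν i (∑ m ∈ Finset.range (j + 1),
        C (kummerCoeff i ν m) * (X ^ m * besselSeries (ν + m + 1))) =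
      C (-(kummerCoeff i ν (j + 1) * ((j + 1) * (2 * ν + 1 + i + j)))) *
          (X ^ (j + 1) * besselSeries (ν + j + 1))
      + C (kummerCoeff i ν j * (i / (8 * (ν + j + 1))
          - j * (j + 2 * ν + i) / (16 * (ν + j) * (ν + j + 1)))) *
          (X ^ (j + 2) * besselSeries (ν + j + 1 + 1)) := by
  have hlast : kummerCoeff i ν (i + 1) = 0 := kummerCoeff_eq_zero ν (Nat.lt_succ_self i)
  induction j with
  | zero =>
    have h1 : -(kummerCoeff i ν 1 * (2 * ν + 1 + i)) = (i : ℂ) / 2 := by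
      rcases Nat.eq_zero_or_pos i with rfl | hi
      · simp [hlast]
      · have h0 := hν 0 hi
        have := kummerCoeff_succ hc h0
        simp only [Nat.cast_zero, add_zero, zero_add, one_mul, kummerCoeff_zero,
          zero_sub] at this h0
        rw [this]
        field_simp
        norm_num
    have h2 := kummerOp_X_pow_mul_besselSeries ν i 0 (hb 0 hj)
    simp only [pow_zero, zero_add, Nat.cast_zero, zero_mul, add_zero, one_mul, map_zero] at h2
    simp only [pow_zero, zero_add, Finset.sum_range_one, kummerCoeff_zero, map_one, one_mul, h2,
      Nat.cast_zero, zero_mul, add_zero, h1, zero_div, sub_zero]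
    ring
  | succ j ih =>
    have hji : j < i := hj
    have hb0 := hb j hji.le
    have hb1 := hb (j + 1) hj
    have hν0 := hν j hji
    have h2 := kummerOp_X_pow_mul_besselSeries ν i (j + 1) hb1
    have hS := besselSeries_sub_besselSeries _ hb0
    have hb0' := hb0.ne_zero
    have hb1' := hb1.ne_zero
    have e : ν + ((j + 1 : ℕ) : ℂ) + 1 = ν + j + 1 + 1 := by push_cast; ring
    have e' : ν + ((j + 1 : ℕ) : ℂ) = ν + j + 1 := by push_cast; ring
    rw [Finset.sum_range_succ, kummerOp_add, kummerOp_C_mul, ih hji.le, h2]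
    rw [e] at hb1' ⊢
    rw [e']
    have hA := kummerCoeff_succ hc hν0
    have hB : kummerCoeff i ν (j + 1 + 1) * ((((j + 1 : ℕ) : ℂ) + 1) *
          (2 * ν + 1 + i + ((j + 1 : ℕ) : ℂ))) =
        kummerCoeff i ν (j + 1) * ((((j + 1 : ℕ) : ℂ) - i) * (2 * ν + ((j + 1 : ℕ) : ℂ))) /
          (4 * (ν + j + 1)) := by
      rcases hj.lt_or_eq with h | h
      · rw [← e']
        exact kummerCoeff_succ hc (hν _ h)
      · rw [show j + 1 + 1 = i + 1 by rw [h], hlast, h]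
        simp
    have s1 : -(kummerCoeff i ν (j + 1 + 1) * ((((j + 1 : ℕ) : ℂ) + 1) *
          (2 * ν + 1 + i + ((j + 1 : ℕ) : ℂ)))) =
        kummerCoeff i ν j * (i / (8 * (ν + j + 1))
          - j * (j + 2 * ν + i) / (16 * (ν + j) * (ν + j + 1)))
        + kummerCoeff i ν (j + 1) * (i / 2) := by
      have hA' : kummerCoeff i ν j * (i / (8 * (ν + j + 1))
          - j * (j + 2 * ν + i) / (16 * (ν + j) * (ν + j + 1))) =
          -(kummerCoeff i ν (j + 1) * ((j + 1) * (2 * ν + 1 + i + j))) / (4 * (ν + j + 1)) := by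
        rw [hA]
        field_simp
        ring
      rw [hA', hB]
      push_cast
      field_simp
      ring
    have s2 : kummerCoeff i ν (j + 1) * (i / (8 * (ν + j + 1 + 1))
          - ((j + 1 : ℕ) : ℂ) * (((j + 1 : ℕ) : ℂ) + 2 * ν + i) /
            (16 * (ν + j + 1) * (ν + j + 1 + 1))) =
        kummerCoeff i ν (j + 1) * (i / (8 * (ν + j + 1 + 1)))
        - kummerCoeff i ν (j + 1) * ((j + 1) * (2 * ν + 1 + i + j)) *
          (1 / (16 * (ν + j + 1) * (ν + j + 1 + 1))) := by
      push_cast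
      ring
    have s3 : ((j + 1 : ℕ) : ℂ) * (((j + 1 : ℕ) : ℂ) + 2 * ν + i) =
        (j + 1) * (2 * ν + 1 + i + j) := by
      push_cast
      ring
    rw [s1, s2, s3]
    generalize (i : ℂ) / (8 * (ν + j + 1))
          - j * (j + 2 * ν + i) / (16 * (ν + j) * (ν + j + 1)) = q
    generalize (i : ℂ) / (8 * (ν + j + 1 + 1)) = r
    generalize (1 : ℂ) / (16 * (ν + j + 1) * (ν + j + 1 + 1)) = s at *
    generalize ((j : ℂ) + 1) * (2 * ν + 1 + i + j) = p
    simp only [map_add, map_sub, map_mul, map_neg]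
    linear_combination - C (kummerCoeff i ν (j + 1)) * C p * X ^ (j + 1) * hS

theorem kummerOp_sum_besselSeries_eq_zero {i : ℕ} {ν : ℂ} (hc : NotNonposInt (2 * ν + 1 + i))
    (hb : ∀ m ≤ i, NotNonposInt (ν + m + 1)) (hν : ∀ m < i, ν + m ≠ 0) :
    kummerOp ν i (∑ m ∈ Finset.range (i + 1),
        C (kummerCoeff i ν m) * (X ^ m * besselSeries (ν + m + 1))) = 0 := by
  rw [kummerOp_sum_besselSeries hc hb hν le_rfl, kummerCoeff_eq_zero ν (Nat.lt_succ_self i)]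
  have hq : (i : ℂ) / (8 * (ν + i + 1)) - i * (i + 2 * ν + i) / (16 * (ν + i) * (ν + i + 1))
      = 0 := by
    cases i with
    | zero => simp
    | succ i =>
      have h1 := (hb (i + 1) le_rfl).ne_zero
      have h2 : ν + ((i + 1 : ℕ) : ℂ) ≠ 0 := by
        have := (hb i (Nat.le_succ i)).ne_zero
        push_cast
        rwa [← add_assoc]
      field_simp
      ring
  rw [hq]
  simp

/-- The formal power series version of the generalized second Kummer transformation. -/
theorem exp_mul_kummerSeries_eq_sum {i : ℕ} {ν : ℂ} (hc : NotNonposInt (2 * ν + 1 + i))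
    (hb : ∀ m ≤ i, NotNonposInt (ν + m + 1)) (hν : ∀ m < i, ν + m ≠ 0) :
    rescale (-1 / 2) (PowerSeries.exp ℂ) * kummerSeries (ν + 1 / 2) (2 * ν + 1 + i) =
      ∑ m ∈ Finset.range (i + 1),
        C (kummerCoeff i ν m) * (X ^ m * besselSeries (ν + m + 1)) := by
  refine eq_of_kummerOp_eq_zero hc (kummerOp_exp_mul_kummerSeries ν i hc)
    (kummerOp_sum_besselSeries_eq_zero hc hb hν) ?_
  rw [Finset.sum_range_succ']
  have hG (b : ℂ) : constantCoeff (besselSeries b) = 1 := by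
    rw [← coeff_zero_eq_constantCoeff_apply]
    simp [besselSeries, poch_zero]
  have hU (a c : ℂ) : constantCoeff (kummerSeries a c) = 1 := by
    rw [← coeff_zero_eq_constantCoeff_apply]
    simp [kummerSeries, poch_zero]
  have hE (a : ℂ) : constantCoeff (rescale a (PowerSeries.exp ℂ)) = 1 := by
    rw [← coeff_zero_eq_constantCoeff_apply]
    simp [coeff_rescale]
  simp [hG, hU, hE, kummerCoeff_zero]

end FormalSeries

section Evaluation

open Filter Topology

theorem tendsto_inv_const_add_natCast (c : ℂ) :
    Tendsto (fun n : ℕ => (c + n)⁻¹) atTop (𝓝 0) :=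
  tendsto_inv₀_cobounded.comp
    ((tendsto_const_add_cobounded c).comp tendsto_natCast_atTop_cobounded)

theorem summable_of_succ_eq_mul {t r : ℕ → ℂ} (ht : ∀ n, t (n + 1) = r n * t n)
    (hr : Tendsto r atTop (𝓝 0)) : Summable t := by
  refine summable_of_ratio_norm_eventually_le (r := 1 / 2) (by norm_num) ?_
  have h := hr.norm.eventually_le_const (u := 1 / 2) (by simp)
  filter_upwards [h] with n hn
  rw [ht, norm_mul]
  exact mul_le_mul_of_nonneg_right hn (norm_nonneg _)

theorem summable_kummerSeries (a c x : ℂ) (hc : NotNonposInt c) :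
    Summable fun n => PowerSeries.coeff n (kummerSeries a c) * x ^ n := by
  refine summable_of_succ_eq_mul
    (r := fun n => x * (1 + n : ℂ)⁻¹ * (1 + (a - c) * (c + n)⁻¹)) (fun n => ?_) ?_
  · simp only [kummerSeries, PowerSeries.coeff_mk, poch_succ, Nat.factorial_succ]
    have h1 := hc.poch_ne_zero n
    have h2 := hc.add_ne_zero n
    have h3 : (Nat.factorial n : ℂ) ≠ 0 := by exact_mod_cast n.factorial_ne_zero
    have h4 : (n : ℂ) + 1 ≠ 0 := by exact_mod_cast n.succ_ne_zero
    rw [add_comm (1 : ℂ) n]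
    push_cast
    field_simp
    ring
  · have h := ((tendsto_inv_const_add_natCast 1).const_mul x).mul
      (((tendsto_inv_const_add_natCast c).const_mul (a - c)).const_add 1)
    simpa using h

theorem summable_pFq_bessel (b z : ℂ) (hb : NotNonposInt b) :
    Summable fun k : ℕ => 1 / poch b k * z ^ k / (Nat.factorial k) := by
  refine summable_of_succ_eq_mul
    (r := fun n => z * (1 + n : ℂ)⁻¹ * (b + n)⁻¹) (fun n => ?_) ?_
  · have h1 := hb.poch_ne_zero n
    have h2 := hb.add_ne_zero n
    have h3 : (Nat.factorial n : ℂ) ≠ 0 := by exact_mod_cast n.factorial_ne_zero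
    have h4 : (n : ℂ) + 1 ≠ 0 := by exact_mod_cast n.succ_ne_zero
    rw [add_comm (1 : ℂ) n, poch_succ, Nat.factorial_succ]
    push_cast
    field_simp
    ring
  · have h := ((tendsto_inv_const_add_natCast 1).const_mul z).mul
      (tendsto_inv_const_add_natCast b)
    simpa using h

theorem hasSum_X_pow_mul_besselSeries (b x : ℂ) (hb : NotNonposInt b) (m : ℕ) :
    HasSum (fun n => PowerSeries.coeff n (PowerSeries.X ^ m * besselSeries b) * x ^ n)
      (x ^ m * pFq [] [b] (x ^ 2 / 16)) := by
  have hinj : Function.Injective fun k : ℕ => 2 * k + m := fun k l h => by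
    simpa using h
  rw [← hinj.hasSum_iff]
  · have h := (summable_pFq_bessel b (x ^ 2 / 16) hb).hasSum.mul_left (x ^ m)
    have hp : pFq [] [b] (x ^ 2 / 16) =
        ∑' k : ℕ, 1 / poch b k * (x ^ 2 / 16) ^ k / (Nat.factorial k) := by
      simp [pFq]
    rw [hp]
    refine (congrArg (fun f => HasSum f _) (funext fun k => ?_)).mpr h
    change PowerSeries.coeff (2 * k + m) _ * x ^ (2 * k + m) = _
    rw [PowerSeries.coeff_X_pow_mul, coeff_besselSeries_two_mul, div_pow, pow_add, pow_mul]
    field_simp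
  · intro n hn
    rw [PowerSeries.coeff_X_pow_mul']
    split_ifs with hmn
    · obtain ⟨k, hk | hk⟩ := (n - m).even_or_odd'
      · exact absurd ⟨k, show 2 * k + m = n by omega⟩ hn
      · rw [hk, coeff_besselSeries_two_mul_add_one, zero_mul]
    · simp

theorem tsum_exp_mul_kummerSeries (a c x : ℂ) (hc : NotNonposInt c) :
    ∑' n, PowerSeries.coeff n (PowerSeries.rescale (-1 / 2) (PowerSeries.exp ℂ) *
        kummerSeries a c) * x ^ n = Complex.exp (-x / 2) * pFq [a] [c] x := by
  have hE : Complex.exp (-x / 2) = ∑' n : ℕ, (-x / 2) ^ n / (Nat.factorial n) := by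
    rw [Complex.exp_eq_exp_ℂ, NormedSpace.exp_eq_tsum_div]
  have hU : pFq [a] [c] x = ∑' n, PowerSeries.coeff n (kummerSeries a c) * x ^ n := by
    simp only [pFq, kummerSeries, PowerSeries.coeff_mk, List.map_cons, List.map_nil,
      List.prod_cons, List.prod_nil, mul_one]
    exact tsum_congr fun n => by ring
  rw [hE, hU, tsum_mul_tsum_eq_tsum_sum_antidiagonal_of_summable_norm
    (NormedSpace.norm_expSeries_div_summable (-x / 2)) (summable_kummerSeries a c x hc).norm]
  refine tsum_congr fun n => ?_
  rw [PowerSeries.coeff_mul, Finset.sum_mul]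
  refine Finset.sum_congr rfl fun p hp => ?_
  rw [← Finset.HasAntidiagonal.mem_antidiagonal.mp hp, PowerSeries.coeff_rescale,
    PowerSeries.coeff_exp, pow_add, show -x / 2 = -1 / 2 * x by ring, mul_pow]
  simp only [map_div₀, map_one, map_natCast]
  ring

end Evaluation

theorem kummer_generalization_plus (i : ℕ) (x α : ℂ)
    (h1 : NotNonposInt (2*α + i))
    (h2 : ∀ m : ℕ, m ≤ i → NotNonposInt (α + m + 1/2))
    (h3 : ∀ m : ℕ, m ≤ i → poch (α - 1/2) m ≠ 0) :
    Complex.exp (-x/2) * pFq [α] [2*α + i] x =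
      ∑ m ∈ Finset.range (i+1),
        (poch (-(i:ℂ)) m * poch (2*α - 1) m) /
          (poch (2*α + i) m * poch (α - 1/2) m * (Nat.factorial m) * 2 ^ (2*m)) *
        x ^ m * pFq [] [α+m+1/2] (x^2/16) := by
  obtain ⟨ν, rfl⟩ : ∃ ν, α = ν + 1 / 2 := ⟨α - 1 / 2, by ring⟩
  have e1 : 2 * (ν + 1 / 2) + (i : ℂ) = 2 * ν + 1 + i := by ring
  have e2 : 2 * (ν + 1 / 2) - 1 = 2 * ν := by ring
  have e3 : ν + 1 / 2 - 1 / 2 = ν := by ring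
  have e4 (m : ℕ) : ν + 1 / 2 + (m : ℂ) + 1 / 2 = ν + m + 1 := by ring
  simp only [e1, e2, e3, e4] at h1 h2 h3 ⊢
  have hν : ∀ m < i, ν + m ≠ 0 := fun m hm =>
    Finset.prod_ne_zero_iff.mp (h3 i le_rfl) m (Finset.mem_range.mpr hm)
  rw [← tsum_exp_mul_kummerSeries _ _ _ h1, exp_mul_kummerSeries_eq_sum h1 h2 hν]
  refine HasSum.tsum_eq ?_
  simp only [map_sum, PowerSeries.coeff_C_mul, Finset.sum_mul, mul_assoc _ (x ^ _) (pFq _ _ _)]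
  refine hasSum_sum fun m hm => ?_
  have h := (hasSum_X_pow_mul_besselSeries _ x
    (h2 m (Nat.lt_succ_iff.mp (Finset.mem_range.mp hm))) m).mul_left (kummerCoeff i ν m)
  simpa only [mul_assoc, kummerCoeff] using h
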